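/- Let L : ℝ^n × ℝ^n × ℝ → ℝ be continuous and bounded below, and suppose f := sup{|L(y,0,s)| : y ∈ ℝ^n, s ∈ ℝ} is finite. Let α ∈ ℝ, let u : ℝ^n → ℝ be bounded, and for λ > 0 define the Lax–Oleinik operator T_λ u(x,t) = inf_{y ∈ ℝ^n} { u(y) + A(t−λ, y; t, x) + λα }. Then for all x ∈ ℝ^n, t ∈ ℝ and all 0 < λ₂ ≤ λ₁, one has T_{λ₁} u(x,t) ≤ T_{λ₂} u(x,t) + (λ₁ − λ₂)(f + |α|). -/

import Mathlib

noncomputable section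

/-- `γ : ℝ → ℝⁿ` is an admissible (Lipschitz) curve from `(s,y)` to `(t,x)`. -/
def IsCurve {n : ℕ} (s t : ℝ) (y x : EuclideanSpace ℝ (Fin n))
    (γ : ℝ → EuclideanSpace ℝ (Fin n)) : Prop :=
  (∃ K : NNReal, LipschitzOnWith K γ (Set.Icc s t)) ∧ γ s = y ∧ γ t = x

/-- The action of `L` along the curve `γ` on `[s,t]`. -/
def curveAction {n : ℕ}
    (L : EuclideanSpace ℝ (Fin n) → EuclideanSpace ℝ (Fin n) → ℝ → ℝ)
    (s t : ℝ) (γ : ℝ → EuclideanSpace ℝ (Fin n)) : ℝ :=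
  ∫ σ in s..t, L (γ σ) (deriv γ σ) σ

/-- The Lagrangian action `A(s,y;t,x)`. -/
def action {n : ℕ}
    (L : EuclideanSpace ℝ (Fin n) → EuclideanSpace ℝ (Fin n) → ℝ → ℝ)
    (s t : ℝ) (y x : EuclideanSpace ℝ (Fin n)) : ℝ :=
  sInf {a | ∃ γ : ℝ → EuclideanSpace ℝ (Fin n), IsCurve s t y x γ ∧ a = curveAction L s t γ}

/-- The Lax–Oleinik operator `T_λ u(x,t) = inf_y { u(y) + A(t−λ,y;t,x) + λα }`. -/
def laxOleinik {n : ℕ}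
    (L : EuclideanSpace ℝ (Fin n) → EuclideanSpace ℝ (Fin n) → ℝ → ℝ)
    (α : ℝ) (u : EuclideanSpace ℝ (Fin n) → ℝ) (lam : ℝ)
    (x : EuclideanSpace ℝ (Fin n)) (t : ℝ) : ℝ :=
  ⨅ y : EuclideanSpace ℝ (Fin n), (u y + action L (t - lam) t y x + lam * α)

open MeasureTheory Set Filter Topology in
/-- The integrand of the action along an admissible curve is integrable. -/
theorem IsCurve.intervalIntegrable {n : ℕ}
    {L : EuclideanSpace ℝ (Fin n) → EuclideanSpace ℝ (Fin n) → ℝ → ℝ}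
    (hL : Continuous (fun q : EuclideanSpace ℝ (Fin n) × EuclideanSpace ℝ (Fin n) × ℝ =>
      L q.1 q.2.1 q.2.2))
    {s t : ℝ} (hst : s ≤ t) {y x : EuclideanSpace ℝ (Fin n)}
    {γ : ℝ → EuclideanSpace ℝ (Fin n)} (hγ : IsCurve s t y x γ) :
    IntervalIntegrable (fun σ => L (γ σ) (deriv γ σ) σ) volume s t := by
  obtain ⟨⟨K, hK⟩, -, -⟩ := hγ
  rw [intervalIntegrable_iff_integrableOn_Ioo_of_le hst]
  have hc : IsCompact ((γ '' Icc s t) ×ˢ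
      (Metric.closedBall (0 : EuclideanSpace ℝ (Fin n)) K ×ˢ Icc s t)) :=
    (isCompact_Icc.image_of_continuousOn hK.continuousOn).prod
      ((isCompact_closedBall _ _).prod isCompact_Icc)
  obtain ⟨C, hC⟩ := hc.exists_bound_of_continuousOn hL.continuousOn
  have hmγ : AEStronglyMeasurable γ (volume.restrict (Ioo s t)) :=
    (hK.continuousOn.mono Ioo_subset_Icc_self).aestronglyMeasurable measurableSet_Ioo
  have hmeas : AEStronglyMeasurable (fun σ => L (γ σ) (deriv γ σ) σ)
      (volume.restrict (Ioo s t)) :=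
    hL.comp_aestronglyMeasurable (hmγ.prodMk
      ((measurable_deriv γ).aestronglyMeasurable.prodMk measurable_id.aestronglyMeasurable))
  refine Integrable.of_bound hmeas C ?_
  filter_upwards [ae_restrict_mem measurableSet_Ioo] with σ hσ
  refine hC (γ σ, deriv γ σ, σ) ⟨mem_image_of_mem _ (Ioo_subset_Icc_self hσ), ?_,
    Ioo_subset_Icc_self hσ⟩
  simpa using norm_deriv_le_of_lipschitzOn (Icc_mem_nhds hσ.1 hσ.2) hK

theorem IsCurve.mul_le_curveAction {n : ℕ}
    {L : EuclideanSpace ℝ (Fin n) → EuclideanSpace ℝ (Fin n) → ℝ → ℝ}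
    (hL : Continuous (fun q : EuclideanSpace ℝ (Fin n) × EuclideanSpace ℝ (Fin n) × ℝ =>
      L q.1 q.2.1 q.2.2))
    {m : ℝ} (hm : ∀ (x v : EuclideanSpace ℝ (Fin n)) (t : ℝ), m ≤ L x v t)
    {s t : ℝ} (hst : s ≤ t) {y x : EuclideanSpace ℝ (Fin n)}
    {γ : ℝ → EuclideanSpace ℝ (Fin n)} (hγ : IsCurve s t y x γ) :
    (t - s) * m ≤ curveAction L s t γ := by
  have h := intervalIntegral.integral_mono_on hst
    (intervalIntegrable_const (c := m)) (hγ.intervalIntegrable hL hst) (fun σ _ => hm _ _ σ)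
  simpa [curveAction] using h

theorem bddBelow_curveAction {n : ℕ}
    {L : EuclideanSpace ℝ (Fin n) → EuclideanSpace ℝ (Fin n) → ℝ → ℝ}
    (hL : Continuous (fun q : EuclideanSpace ℝ (Fin n) × EuclideanSpace ℝ (Fin n) × ℝ =>
      L q.1 q.2.1 q.2.2))
    {m : ℝ} (hm : ∀ (x v : EuclideanSpace ℝ (Fin n)) (t : ℝ), m ≤ L x v t)
    {s t : ℝ} (hst : s ≤ t) (y x : EuclideanSpace ℝ (Fin n)) :
    (t - s) * m ∈ lowerBounds {a | ∃ γ : ℝ → EuclideanSpace ℝ (Fin n),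
      IsCurve s t y x γ ∧ a = curveAction L s t γ} := by
  rintro a ⟨γ, hγ, rfl⟩
  exact hγ.mul_le_curveAction hL hm hst

theorem exists_isCurve {n : ℕ} {s t : ℝ} (hst : s < t) (y x : EuclideanSpace ℝ (Fin n)) :
    ∃ γ, IsCurve s t y x γ := by
  refine ⟨fun σ => AffineMap.lineMap y x ((σ - s) / (t - s)), ?_, by simp, ?_⟩
  · refine ⟨nndist y x * ‖(t - s)⁻¹‖₊, LipschitzWith.lipschitzOnWith ?_⟩
    refine (lipschitzWith_lineMap y x).comp (LipschitzWith.of_dist_le_mul fun a b => ?_)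
    rw [Real.dist_eq, Real.dist_eq, ← sub_div, sub_sub_sub_cancel_right, div_eq_inv_mul, abs_mul]
    simp
  · simp [div_self (sub_pos.2 hst).ne']

/-- An admissible curve extends backwards in time by staying at its initial point. -/
theorem IsCurve.comp_max {n : ℕ} {s r t : ℝ} (hrt : r ≤ t) (hsr : s ≤ r)
    {y x : EuclideanSpace ℝ (Fin n)} {γ : ℝ → EuclideanSpace ℝ (Fin n)}
    (hγ : IsCurve r t y x γ) : IsCurve s t y x (fun σ => γ (max σ r)) := by
  obtain ⟨⟨K, hK⟩, hr, ht⟩ := hγ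
  refine ⟨⟨K * 1, hK.comp (LipschitzWith.id.max_const r).lipschitzOnWith ?_⟩, ?_, ?_⟩
  · exact fun σ hσ => ⟨le_max_right _ _, max_le hσ.2 hrt⟩
  · simp [max_eq_right hsr, hr]
  · simp [max_eq_left hrt, ht]

open Set Filter Topology in
theorem IsCurve.curveAction_comp_max_le {n : ℕ}
    {L : EuclideanSpace ℝ (Fin n) → EuclideanSpace ℝ (Fin n) → ℝ → ℝ}
    (hL : Continuous (fun q : EuclideanSpace ℝ (Fin n) × EuclideanSpace ℝ (Fin n) × ℝ =>
      L q.1 q.2.1 q.2.2))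
    {f : ℝ} (hf : ∀ (y : EuclideanSpace ℝ (Fin n)) (s : ℝ), |L y 0 s| ≤ f)
    {s r t : ℝ} (hrt : r ≤ t) (hsr : s ≤ r)
    {y x : EuclideanSpace ℝ (Fin n)} {γ : ℝ → EuclideanSpace ℝ (Fin n)}
    (hγ : IsCurve r t y x γ) :
    curveAction L s t (fun σ => γ (max σ r)) ≤ (r - s) * f + curveAction L r t γ := by
  have hI := (hγ.comp_max hrt hsr).intervalIntegrable hL (hsr.trans hrt)
  have hI₁ := hI.mono_set (c := s) (d := r)
    (by rw [uIcc_of_le hsr, uIcc_of_le (hsr.trans hrt)]; exact Icc_subset_Icc_right hrt)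
  have hI₂ := hI.mono_set (c := r) (d := t)
    (by rw [uIcc_of_le hrt, uIcc_of_le (hsr.trans hrt)]; exact Icc_subset_Icc_left hsr)
  rw [curveAction, ← intervalIntegral.integral_add_adjacent_intervals hI₁ hI₂]
  refine add_le_add ?_ (le_of_eq ?_)
  · have h := intervalIntegral.integral_mono_on_of_le_Ioo hsr hI₁
      (intervalIntegrable_const (c := f)) (fun σ hσ => ?_)
    · simpa using h
    · have hd : (fun σ => γ (max σ r)) =ᶠ[𝓝 σ] fun _ => γ r := by
        filter_upwards [Iio_mem_nhds hσ.2] with τ hτ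
        rw [max_eq_right hτ.le]
      rw [hd.deriv_eq, deriv_const]
      exact (le_abs_self _).trans (hf _ _)
  · refine intervalIntegral.integral_congr_Ioo_of_le hrt fun σ hσ => ?_
    have hd : (fun σ => γ (max σ r)) =ᶠ[𝓝 σ] γ := by
      filter_upwards [Ioi_mem_nhds hσ.1] with τ hτ
      rw [max_eq_left hτ.le]
    simp only [hd.deriv_eq, max_eq_left hσ.1.le]

/-- Prolonging the time interval by waiting at the initial point costs at most `f` per unit time. -/
theorem action_le_add_action {n : ℕ}
    {L : EuclideanSpace ℝ (Fin n) → EuclideanSpace ℝ (Fin n) → ℝ → ℝ}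
    (hL : Continuous (fun q : EuclideanSpace ℝ (Fin n) × EuclideanSpace ℝ (Fin n) × ℝ =>
      L q.1 q.2.1 q.2.2))
    {m : ℝ} (hm : ∀ (x v : EuclideanSpace ℝ (Fin n)) (t : ℝ), m ≤ L x v t)
    {f : ℝ} (hf : ∀ (y : EuclideanSpace ℝ (Fin n)) (s : ℝ), |L y 0 s| ≤ f)
    {s r t : ℝ} (hrt : r < t) (hsr : s ≤ r) (y x : EuclideanSpace ℝ (Fin n)) :
    action L s t y x ≤ (r - s) * f + action L r t y x := by
  rw [← sub_le_iff_le_add']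
  obtain ⟨γ₀, hγ₀⟩ := exists_isCurve hrt y x
  refine le_csInf ⟨_, γ₀, hγ₀, rfl⟩ ?_
  rintro a ⟨γ, hγ, rfl⟩
  rw [sub_le_iff_le_add']
  exact (csInf_le ⟨_, bddBelow_curveAction hL hm (hsr.trans hrt.le) y x⟩
    ⟨_, hγ.comp_max hrt.le hsr, rfl⟩).trans (hγ.curveAction_comp_max_le hL hf hrt.le hsr)

/-- Lipschitz-in-`λ` estimate for the Lax–Oleinik operator:
`T_{λ₁}u(x,t) ≤ T_{λ₂}u(x,t) + (λ₁−λ₂)(f + |α|)` for `0 < λ₂ ≤ λ₁`, where `f` bounds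
`|L(y,0,s)|`. -/
theorem stmt_17 (n : ℕ)
    (L : EuclideanSpace ℝ (Fin n) → EuclideanSpace ℝ (Fin n) → ℝ → ℝ)
    (hL : Continuous (fun q : EuclideanSpace ℝ (Fin n) × EuclideanSpace ℝ (Fin n) × ℝ =>
      L q.1 q.2.1 q.2.2))
    (hbdd : ∃ m : ℝ, ∀ (x v : EuclideanSpace ℝ (Fin n)) (t : ℝ), m ≤ L x v t)
    (f : ℝ) (hf : ∀ (y : EuclideanSpace ℝ (Fin n)) (s : ℝ), |L y 0 s| ≤ f)
    (α : ℝ) (u : EuclideanSpace ℝ (Fin n) → ℝ) (hu : ∃ B : ℝ, ∀ y, |u y| ≤ B) :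
    ∀ (x : EuclideanSpace ℝ (Fin n)) (t : ℝ) (lam₁ lam₂ : ℝ), 0 < lam₂ → lam₂ ≤ lam₁ →
      laxOleinik L α u lam₁ x t ≤ laxOleinik L α u lam₂ x t + (lam₁ - lam₂) * (f + |α|) := by
  intro x t lam₁ lam₂ h₂ h₁₂
  obtain ⟨m, hm⟩ := hbdd
  obtain ⟨B, hB⟩ := hu
  rw [← sub_le_iff_le_add]
  refine le_ciInf fun y => ?_
  rw [sub_le_iff_le_add]
  have hbelow : BddBelow (Set.range fun y => u y + action L (t - lam₁) t y x + lam₁ * α) := by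
    refine ⟨-B + (t - (t - lam₁)) * m + lam₁ * α, ?_⟩
    rintro _ ⟨z, rfl⟩
    obtain ⟨γ, hγ⟩ := exists_isCurve (show t - lam₁ < t by linarith) z x
    have hA : (t - (t - lam₁)) * m ≤ action L (t - lam₁) t z x :=
      le_csInf ⟨_, γ, hγ, rfl⟩ (bddBelow_curveAction hL hm (by linarith) z x)
    have hz := (abs_le.1 (hB z)).1
    dsimp only
    linarith
  refine (ciInf_le hbelow y).trans ?_
  have hA := action_le_add_action hL hm hf (show t - lam₂ < t by linarith)
    (show t - lam₁ ≤ t - lam₂ by linarith) y x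
  have hα := mul_le_mul_of_nonneg_left (le_abs_self α) (sub_nonneg.2 h₁₂)
  linarith
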